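/- Let m ≥ 1 be an integer, let ζ₁,…,ζ_{N−1} ∈ 𝔻 be finitely many points, and let ε > 0. Set U_ε := ⋃_{x ∈ [0,1]} D(x, ε), the open ε-neighborhood of the segment [0,1] in ℂ. Then there exist a holomorphic function h on 𝔻 with h(𝔻) ⊆ U_ε and a point ζ* ∈ 𝔻 such that: h(0) = 0; h⁽ᵏ⁾(ζⱼ) = 0 for all 0 ≤ k ≤ m−1 and 1 ≤ j ≤ N−1; h(ζ*) = 1; and h⁽ᵏ⁾(ζ*) = 0 for all 1 ≤ k ≤ m−1. -/

import Mathlib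

open Complex Metric Filter Topology

noncomputable section

/-- The open unit disc in `ℂ`. -/
def unitDisc : Set ℂ := Metric.ball 0 1

/-- Extended-real logarithm, with the convention `log 0 = ⊥`. -/
def elog (x : ℝ) : EReal := if x = 0 then ⊥ else ((Real.log x : ℝ) : EReal)

/-- The Möbius involution of the unit disc exchanging `ξ` and `0`. -/
def mobius (ξ ζ : ℂ) : ℂ := (ξ - ζ) / (1 - (starRingEnd ℂ) ξ * ζ)

lemma key_deriv (f Φ : ℂ → ℂ) (x : ℂ) (m : ℕ) (hf : AnalyticAt ℂ f x) (hf0 : f x = 0)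
    (hΦ : AnalyticAt ℂ Φ 0) (ho : (m : ℕ∞) ≤ analyticOrderAt f x) (k : ℕ) (hk : 1 ≤ k)
    (hkm : k < m) : iteratedDeriv k (fun z => Φ (f z)) x = 0 := by
  have hΨ : AnalyticAt ℂ (fun w => Φ w - Φ 0) 0 := hΦ.sub analyticAt_const
  have h1 : ((1 : ℕ) : ℕ∞) ≤ analyticOrderAt (fun w => Φ w - Φ 0) 0 := by
    rw [natCast_le_analyticOrderAt_iff_iteratedDeriv_eq_zero hΨ]
    intro i hi
    obtain rfl : i = 0 := by omega
    simp
  obtain ⟨g, hg, hge⟩ := (natCast_le_analyticOrderAt hΨ).1 h1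
  obtain ⟨q, hq, hqe⟩ := (natCast_le_analyticOrderAt hf).1 ho
  have hΦf : AnalyticAt ℂ (fun z => Φ (f z)) x := by
    have : AnalyticAt ℂ Φ (f x) := by rw [hf0]; exact hΦ
    exact this.comp hf
  have hgf : AnalyticAt ℂ (fun z => g (f z)) x := by
    have : AnalyticAt ℂ g (f x) := by rw [hf0]; exact hg
    exact this.comp hf
  have hH : AnalyticAt ℂ (fun z => Φ (f z) - Φ 0) x := hΦf.sub analyticAt_const
  have ht : Tendsto f (𝓝 x) (𝓝 0) := by
    have := hf.continuousAt.tendsto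
    rwa [hf0] at this
  have h2 : (m : ℕ∞) ≤ analyticOrderAt (fun z => Φ (f z) - Φ 0) x := by
    rw [natCast_le_analyticOrderAt hH]
    refine ⟨fun z => q z * g (f z), hq.mul hgf, ?_⟩
    filter_upwards [hqe, ht.eventually hge] with z hz1 hz2
    rw [hz2]
    simp only [smul_eq_mul, sub_zero, pow_one] at *
    rw [← mul_assoc, ← hz1]
  have h3 := (natCast_le_analyticOrderAt_iff_iteratedDeriv_eq_zero hH).1 h2 k hkm
  rw [iteratedDeriv_fun_sub hΦf.contDiffAt contDiffAt_const, iteratedDeriv_const] at h3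
  rw [if_neg (by omega), sub_zero] at h3
  exact h3

lemma den_ne (ξ z : ℂ) (hξ : ‖ξ‖ < 1) (hz : ‖z‖ ≤ 1) : 1 - (starRingEnd ℂ) ξ * z ≠ 0 := by
  intro h
  have h1 : (starRingEnd ℂ) ξ * z = 1 := (sub_eq_zero.1 h).symm
  have h2 : ‖(starRingEnd ℂ) ξ * z‖ = 1 := by rw [h1]; simp
  rw [norm_mul, RCLike.norm_conj] at h2
  nlinarith [norm_nonneg ξ, norm_nonneg z]

lemma mobius_identity (ξ z : ℂ) :
    ‖1 - (starRingEnd ℂ) ξ * z‖ ^ 2 - ‖ξ - z‖ ^ 2 = (1 - ‖ξ‖ ^ 2) * (1 - ‖z‖ ^ 2) := by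
  simp only [← Complex.normSq_eq_norm_sq, Complex.normSq_apply]
  simp
  ring

lemma mobius_lt (ξ z : ℂ) (hξ : ‖ξ‖ < 1) (hz : ‖z‖ < 1) : ‖mobius ξ z‖ < 1 := by
  have h0 := norm_pos_iff.2 (den_ne ξ z hξ hz.le)
  rw [mobius, norm_div, div_lt_one h0]
  have h1 := mobius_identity ξ z
  have h2 : 0 < (1 - ‖ξ‖ ^ 2) * (1 - ‖z‖ ^ 2) := by
    apply mul_pos <;> nlinarith [norm_nonneg ξ, norm_nonneg z]
  exact lt_of_pow_lt_pow_left₀ 2 h0.le (by linarith)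

lemma mobius_one (ξ : ℂ) (hξ : ‖ξ‖ < 1) : ‖mobius ξ 1‖ = 1 := by
  have h0 := norm_pos_iff.2 (den_ne ξ 1 hξ (by simp))
  rw [mobius, norm_div, div_eq_one_iff_eq h0.ne']
  have h1 := mobius_identity ξ 1
  simp only [norm_one] at h1
  exact (pow_left_inj₀ (norm_nonneg _) h0.le two_ne_zero).1 (by linarith)

lemma mobius_analytic (ξ z : ℂ) (hξ : ‖ξ‖ < 1) (hz : ‖z‖ ≤ 1) :
    AnalyticAt ℂ (mobius ξ) z := by
  unfold mobius
  exact (analyticAt_const.sub analyticAt_id).div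
    (analyticAt_const.sub (analyticAt_const.mul analyticAt_id)) (den_ne ξ z hξ hz)

lemma order_of_zero (f : ℂ → ℂ) (x : ℂ) (m : ℕ) (hf : AnalyticAt ℂ f x) (h0 : f x = 0) :
    (m : ℕ∞) ≤ analyticOrderAt (fun z => f z ^ m) x := by
  have h1 : ((1 : ℕ) : ℕ∞) ≤ analyticOrderAt f x := by
    rw [natCast_le_analyticOrderAt_iff_iteratedDeriv_eq_zero hf]
    intro i hi
    obtain rfl : i = 0 := by omega
    simpa
  obtain ⟨g, hg, hge⟩ := (natCast_le_analyticOrderAt hf).1 h1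
  rw [natCast_le_analyticOrderAt (hf.fun_pow m)]
  refine ⟨fun z => g z ^ m, hg.pow m, ?_⟩
  filter_upwards [hge] with z hz
  rw [hz]
  simp [mul_pow]

lemma range_lemma (ε c δ : ℝ) (hε : 0 < ε) (hc : c = ε / 12) (hδ : δ = ε / 3) (v : ℂ)
    (hv1 : Real.exp (-(1 + δ) / c) ≤ ‖v‖) (hv2 : ‖v‖ ≤ 2) :
    1 + (c : ℂ) * Complex.log v ∈ ⋃ x ∈ Set.Icc (0:ℝ) 1, Metric.ball ((x : ℂ)) ε := by
  have hc0 : 0 < c := by rw [hc]; positivity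
  have hv0 : 0 < ‖v‖ := lt_of_lt_of_le (Real.exp_pos _) hv1
  have hre : (1 + (c : ℂ) * Complex.log v).re = 1 + c * Real.log ‖v‖ := by
    simp [Complex.log_re]
  have him : (1 + (c : ℂ) * Complex.log v).im = c * v.arg := by
    simp [Complex.log_im]
  have hl1 : -(1 + δ) ≤ c * Real.log ‖v‖ := by
    have := (Real.le_log_iff_exp_le hv0).2 hv1
    rw [div_le_iff₀ hc0] at this
    linarith
  have hl2 : c * Real.log ‖v‖ ≤ c := by
    have h1 : Real.log ‖v‖ ≤ ‖v‖ - 1 := Real.log_le_sub_one_of_pos hv0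
    nlinarith
  have hi : |c * v.arg| ≤ ε / 3 := by
    rw [abs_mul, abs_of_pos hc0]
    have := Complex.abs_arg_le_pi v
    have := Real.pi_lt_four
    rw [hc]
    nlinarith
  simp only [Set.mem_iUnion]
  set r := 1 + c * Real.log ‖v‖ with hr
  refine ⟨max 0 (min r 1), ⟨le_max_left _ _, max_le zero_le_one (min_le_right _ _)⟩, ?_⟩
  rw [Metric.mem_ball, dist_eq_norm]
  refine lt_of_le_of_lt (Complex.norm_le_abs_re_add_abs_im _) ?_
  rw [Complex.sub_re, Complex.sub_im, hre, him, Complex.ofReal_re, Complex.ofReal_im, sub_zero]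
  have : |r - max 0 (min r 1)| ≤ ε / 3 := by
    rw [abs_le]
    rcases le_total r 1 with h | h
    · rw [min_eq_left h]
      rcases le_total 0 r with h' | h'
      · rw [max_eq_right h']; constructor <;> linarith
      · rw [max_eq_left h']; constructor <;> linarith
    · rw [min_eq_right h, max_eq_right zero_le_one]; constructor <;> linarith
  linarith

theorem exists_interpolating_function
    (m : ℕ) (hm : 1 ≤ m) (N : ℕ) (ζ : Fin N → ℂ) (hζ : ∀ j, ζ j ∈ unitDisc)
    (ε : ℝ) (hε : 0 < ε) :
    ∃ (h : ℂ → ℂ) (ζstar : ℂ), ζstar ∈ unitDisc ∧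
      DifferentiableOn ℂ h unitDisc ∧
      (∀ w ∈ unitDisc, h w ∈ ⋃ x ∈ Set.Icc (0:ℝ) 1, Metric.ball ((x : ℂ)) ε) ∧
      h 0 = 0 ∧
      (∀ j, ∀ k < m, iteratedDeriv k h (ζ j) = 0) ∧
      h ζstar = 1 ∧
      (∀ k, 1 ≤ k → k ≤ m - 1 → iteratedDeriv k h ζstar = 0) := by
  have hmem : ∀ z, z ∈ unitDisc ↔ ‖z‖ < 1 := fun z => by simp [unitDisc]
  simp only [hmem] at hζ ⊢
  obtain ⟨c, hc⟩ : ∃ c, c = ε / 12 := ⟨_, rfl⟩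
  obtain ⟨δ, hδ⟩ : ∃ δ, δ = ε / 3 := ⟨_, rfl⟩
  have hc0 : 0 < c := by rw [hc]; positivity
  have hδ0 : 0 < δ := by rw [hδ]; positivity
  obtain ⟨ρ, hρ⟩ : ∃ ρ, ρ = 1 - Real.exp (-1 / c) := ⟨_, rfl⟩
  obtain ⟨R, hR⟩ : ∃ R, R = 1 - Real.exp (-(1 + δ) / c) := ⟨_, rfl⟩
  have hρ0 : 0 < ρ := by
    rw [hρ, sub_pos, Real.exp_lt_one_iff]
    exact div_neg_of_neg_of_pos (by norm_num) hc0
  have hρR : ρ < R := by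
    rw [hρ, hR]
    have : -(1 + δ) / c < -1 / c := by
      apply div_lt_div_of_pos_right _ hc0; linarith
    have := Real.exp_lt_exp.2 this
    linarith
  have hR0 : 0 < R := hρ0.trans hρR
  have hR1 : R < 1 := by rw [hR]; linarith [Real.exp_pos (-(1 + δ) / c)]
  -- the Blaschke product
  obtain ⟨B, hB⟩ : ∃ B : ℂ → ℂ, B = fun z => z * ∏ j, mobius (ζ j) z ^ m := ⟨_, rfl⟩
  have hBan : ∀ z, ‖z‖ ≤ 1 → AnalyticAt ℂ B z := by
    intro z hz
    rw [hB]
    refine analyticAt_id.mul ?_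
    exact Finset.analyticAt_fun_prod _ (fun j _ => (mobius_analytic (ζ j) z (hζ j) hz).pow m)
  have hBlt : ∀ z, ‖z‖ < 1 → ‖B z‖ < 1 := by
    intro z hz
    rw [hB]
    simp only [norm_mul, norm_prod, norm_pow]
    have : ∏ j, ‖mobius (ζ j) z‖ ^ m ≤ 1 :=
      Finset.prod_le_one (fun j _ => by positivity)
        (fun j _ => pow_le_one₀ (norm_nonneg _) (mobius_lt _ _ (hζ j) hz).le)
    have h0 : 0 ≤ ∏ j, ‖mobius (ζ j) z‖ ^ m := Finset.prod_nonneg (fun j _ => by positivity)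
    nlinarith [norm_nonneg z]
  have hB1 : ‖B 1‖ = 1 := by
    rw [hB]
    simp [norm_prod, mobius_one _ (hζ _)]
  have hB0 : B 0 = 0 := by rw [hB]; simp
  have hBζ : ∀ j, (m : ℕ∞) ≤ analyticOrderAt B (ζ j) := by
    intro j
    rw [natCast_le_analyticOrderAt (hBan _ (hζ j).le)]
    have ho := order_of_zero (mobius (ζ j)) (ζ j) m (mobius_analytic _ _ (hζ j) (hζ j).le)
      (by simp [mobius])
    rw [natCast_le_analyticOrderAt ((mobius_analytic _ _ (hζ j) (hζ j).le).fun_pow m)] at ho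
    obtain ⟨g, hg, hge⟩ := ho
    refine ⟨fun z => g z * (z * ∏ i ∈ Finset.univ.erase j, mobius (ζ i) z ^ m),
      hg.mul (analyticAt_id.mul (Finset.analyticAt_fun_prod _
        (fun i _ => (mobius_analytic (ζ i) _ (hζ i) (hζ j).le).pow m))), ?_⟩
    filter_upwards [hge] with z hz
    rw [hB]
    simp only [smul_eq_mul] at hz ⊢
    rw [← Finset.mul_prod_erase _ _ (Finset.mem_univ j), hz]
    ring
  have hBζ0 : ∀ j, B (ζ j) = 0 := by
    intro j
    rw [hB]
    simp only
    rw [Finset.prod_eq_zero (Finset.mem_univ j), mul_zero]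
    simp [mobius]; omega
  -- choice of the point
  obtain ⟨t, ht, htB⟩ : ∃ t : ℂ, ‖t‖ < 1 ∧ ρ / R < ‖B t‖ ^ m := by
    have hcont : ContinuousAt (fun z => ‖B z‖ ^ m) 1 :=
      ((hBan 1 (by simp)).continuousAt.norm).pow m
    have hev : ∀ᶠ z in 𝓝 (1:ℂ), ρ / R < ‖B z‖ ^ m := by
      apply hcont.eventually (lt_mem_nhds _)
      simp only
      rw [hB1, one_pow, div_lt_one hR0]
      exact hρR
    have hcl : (1:ℂ) ∈ closure (Metric.ball (0:ℂ) 1) := by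
      rw [closure_ball _ one_ne_zero]; simp
    obtain ⟨t, h1, h2⟩ := mem_closure_iff_nhds.1 hcl _ hev
    exact ⟨t, by simpa using h2, h1⟩
  obtain ⟨b, hb⟩ : ∃ b, b = B t := ⟨_, rfl⟩
  rw [← hb] at htB
  have hb1 : ‖b‖ < 1 := hb ▸ hBlt t ht
  have hbm : 0 < ‖b‖ ^ m := (div_pos hρ0 hR0).trans htB
  have hbm0 : b ^ m ≠ 0 := by
    rw [← norm_pos_iff, norm_pow]; exact hbm
  obtain ⟨s, hs⟩ : ∃ s : ℂ, s = (ρ : ℂ) / b ^ m := ⟨_, rfl⟩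
  have hsR : ‖s‖ ≤ R := by
    rw [hs, norm_div, norm_pow, Complex.norm_real, Real.norm_of_nonneg hρ0.le, div_le_iff₀ hbm]
    rw [div_lt_iff₀ hR0] at htB
    linarith
  -- outer function
  have hsw : ∀ w : ℂ, ‖w‖ < 1 → ‖s * w‖ ≤ R := by
    intro w hw
    rw [norm_mul]
    nlinarith [norm_nonneg s, norm_nonneg w]
  obtain ⟨G, hG⟩ : ∃ G : ℂ → ℂ, G = fun w => 1 + (c : ℂ) * Complex.log (1 - s * w) := ⟨_, rfl⟩
  have hGan : ∀ w, ‖w‖ < 1 → AnalyticAt ℂ G w := by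
    intro w hw
    rw [hG]
    refine analyticAt_const.add (analyticAt_const.mul (AnalyticAt.clog
      (analyticAt_const.sub (analyticAt_const.mul analyticAt_id)) ?_))
    left
    have := (Complex.abs_re_le_norm (s * w)).trans (hsw w hw)
    have := (abs_le.1 this).2
    simp only [id, Complex.sub_re, Complex.one_re]
    linarith
  have hG0 : G 0 = 1 := by rw [hG]; simp
  have hGb : G (b ^ m) = 0 := by
    rw [hG, hs]
    simp only
    rw [div_mul_cancel₀ _ hbm0, hρ]
    have : (1 : ℂ) - ((1 - Real.exp (-1 / c) : ℝ) : ℂ) = ((Real.exp (-1 / c) : ℝ) : ℂ) := by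
      push_cast; ring
    rw [this, ← Complex.ofReal_log (Real.exp_pos _).le, Real.log_exp, ← Complex.ofReal_mul,
      mul_div_cancel₀ _ hc0.ne']
    simp
  have hCan : ∀ w, ‖w‖ < 1 → AnalyticAt ℂ (fun w => mobius b w ^ m) w :=
    fun w hw => (mobius_analytic b w hb1 hw.le).pow m
  have hClt : ∀ w, ‖w‖ < 1 → ‖mobius b w ^ m‖ < 1 := by
    intro w hw
    rw [norm_pow]
    exact pow_lt_one₀ (norm_nonneg _) (mobius_lt b w hb1 hw) (by omega)
  have hΦan : ∀ w, ‖w‖ < 1 → AnalyticAt ℂ (fun w => G (mobius b w ^ m)) w :=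
    fun w hw => (hGan _ (hClt w hw)).comp (f := fun w => mobius b w ^ m) (hCan w hw)
  have hhan : ∀ z, ‖z‖ < 1 → AnalyticAt ℂ (fun z => G (mobius b (B z) ^ m)) z :=
    fun z hz => (hΦan _ (hBlt z hz)).comp (f := B) (hBan z hz.le)
  have hMz : mobius b 0 = b := by simp [mobius]
  have hMb : mobius b b = 0 := by simp [mobius]
  have hm0 : m ≠ 0 := by omega
  refine ⟨fun z => G (mobius b (B z) ^ m), t, ht, ?_, ?_, ?_, ?_, ?_, ?_⟩
  · intro z hz
    exact (hhan z ((hmem z).1 hz)).differentiableAt.differentiableWithinAt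
  · intro w hw
    have h1 := hsw _ (hClt _ (hBlt w hw))
    rw [hG]
    apply range_lemma ε c δ hε hc hδ
    · have := norm_sub_norm_le (1:ℂ) (s * mobius b (B w) ^ m)
      rw [norm_one] at this
      linarith
    · have := norm_sub_le (1:ℂ) (s * mobius b (B w) ^ m)
      rw [norm_one] at this
      linarith
  · simp only [hB0, hMz, hGb]
  · intro j k hk
    rcases Nat.eq_zero_or_pos k with rfl | hk0
    · simp only [iteratedDeriv_zero, hBζ0, hMz, hGb]
    · exact key_deriv B (fun w => G (mobius b w ^ m)) (ζ j) m (hBan _ (hζ j).le) (hBζ0 j)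
        (hΦan 0 (by simp)) (hBζ j) k hk0 hk
  · simp only [← hb, hMb, zero_pow hm0, hG0]
  · intro k hk1 hk2
    have hMan : AnalyticAt ℂ (fun z => mobius b (B z)) t :=
      (mobius_analytic b _ hb1 (hBlt t ht).le).comp (f := B) (hBan t ht.le)
    have hM0 : mobius b (B t) = 0 := by rw [← hb, hMb]
    exact key_deriv (fun z => mobius b (B z) ^ m) G t m (hMan.pow m)
      (by simp only [hM0, zero_pow hm0]) (hGan 0 (by simp))
      (order_of_zero _ t m hMan hM0) k hk1 (by omega)
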